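/- arXiv:1611.04345 — 3 statements merged into one kernel-verified Lean document; each statement's English description precedes it below -/
import Mathlib

section
/- Let A be a commutative Noetherian ring and I ⊆ S_A an ideal such that B = S_A/I is a finitely generated flat A-module. Identify Hom_A(B, A) with the A-submodule {f ∈ P_A : f(I) = 0} of P_A. Suppose F ∈ P_A generates Hom_A(B, A) as an S_A-module, i.e., S_A·F = {f ∈ P_A : f(I) = 0}. Then I = Ann(F) (so B = Apolar(F)); moreover S_A ≅ Ann(F) ⊕ Apolar(F) as A-modules, there is a short exact sequence of A-modules 0 → S_A·F → P_A → Hom_A(Ann(F), A) → 0, and P_A/(S_A·F) ≅ Hom_A(Ann(F), A) is a flat A-module, i.e., the apolar family Spec Apolar(F) → Spec A is flatly embedded. -/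
noncomputable section

open MvPolynomial

namespace RelativeApolarity

variable {A : Type*} [CommRing A] {n : ℕ}

/-- The precomposition action of `σ ∈ S_A` on `f ∈ P_A = Hom_A(S_A, A)`:
`(σ·f)(τ) = f(στ)`. -/
def pact (σ : MvPolynomial (Fin n) A) (f : Module.Dual A (MvPolynomial (Fin n) A)) :
    Module.Dual A (MvPolynomial (Fin n) A) :=
  f ∘ₗ LinearMap.mulLeft A σ

lemma pact_apply (σ τ : MvPolynomial (Fin n) A) (f : Module.Dual A (MvPolynomial (Fin n) A)) :
    pact σ f τ = f (σ * τ) := rfl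

lemma pact_zero (f : Module.Dual A (MvPolynomial (Fin n) A)) : pact 0 f = 0 := by
  apply LinearMap.ext; intro ρ
  show f (0 * ρ) = 0
  rw [zero_mul, map_zero]

lemma pact_add (σ τ : MvPolynomial (Fin n) A) (f : Module.Dual A (MvPolynomial (Fin n) A)) :
    pact (σ + τ) f = pact σ f + pact τ f := by
  apply LinearMap.ext; intro ρ
  show f ((σ + τ) * ρ) = f (σ * ρ) + f (τ * ρ)
  rw [add_mul, map_add]

lemma pact_smul (a : A) (σ : MvPolynomial (Fin n) A)
    (f : Module.Dual A (MvPolynomial (Fin n) A)) :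
    pact (a • σ) f = a • pact σ f := by
  apply LinearMap.ext; intro ρ
  show f ((a • σ) * ρ) = a • f (σ * ρ)
  rw [smul_mul_assoc, map_smul]

lemma pact_mul (σ τ : MvPolynomial (Fin n) A) (f : Module.Dual A (MvPolynomial (Fin n) A)) :
    pact (σ * τ) f = pact σ (pact τ f) := by
  apply LinearMap.ext; intro ρ
  show f (σ * τ * ρ) = f (τ * (σ * ρ))
  exact congrArg f (by ring)

/-- The apolar ideal `Ann(F) = {σ ∈ S_A : σ·F = 0}`. -/
def annRel (F : Module.Dual A (MvPolynomial (Fin n) A)) : Ideal (MvPolynomial (Fin n) A) where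
  carrier := {σ | pact σ F = 0}
  zero_mem' := pact_zero F
  add_mem' := by
    intro a b ha hb
    show pact (a + b) F = 0
    rw [pact_add, ha, hb, add_zero]
  smul_mem' := by
    intro c x hx
    show pact (c • x) F = 0
    rw [smul_eq_mul, pact_mul, hx]
    show (0 : Module.Dual A (MvPolynomial (Fin n) A)) ∘ₗ _ = 0
    exact LinearMap.zero_comp _

/-- The `A`-linear map `σ ↦ σ·F`. -/
def actMap (F : Module.Dual A (MvPolynomial (Fin n) A)) :
    MvPolynomial (Fin n) A →ₗ[A] Module.Dual A (MvPolynomial (Fin n) A) where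
  toFun σ := pact σ F
  map_add' σ τ := pact_add σ τ F
  map_smul' a σ := pact_smul a σ F

/-- The `A`-submodule `S_A·F ⊆ P_A`. -/
def SAF (F : Module.Dual A (MvPolynomial (Fin n) A)) :
    Submodule A (Module.Dual A (MvPolynomial (Fin n) A)) :=
  LinearMap.range (actMap F)

/-- The embedding `A[x₁,…,xₙ] ↪ P_A` sending the monomial `x^b` to the functional taking
`α^a` to `1` if `a = b` and to `0` otherwise. -/
def polyToDual : MvPolynomial (Fin n) A →ₗ[A] Module.Dual A (MvPolynomial (Fin n) A) :=
  (MvPolynomial.basisMonomials (Fin n) A).toDual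

/-- Base change `P_A → P_B` of functionals: `F_B` is the `B`-linear extension of
`φ ∘ F`, i.e. the functional with `F_B(α^m) = φ(F(α^m))`. -/
def dualBC (B : Type*) [CommRing B] [Algebra A B] :
    Module.Dual A (MvPolynomial (Fin n) A) →ₗ[A] Module.Dual B (MvPolynomial (Fin n) B) :=
  ((((MvPolynomial.basisMonomials (Fin n) B).constr A).toLinearMap).comp
    ((LinearMap.compLeft (Algebra.linearMap A B) ((Fin n) →₀ ℕ)).comp
      (LinearMap.pi fun m : (Fin n) →₀ ℕ =>
        LinearMap.applyₗ (MvPolynomial.monomial m (1 : A)))))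

/-- Powers of a Noetherian ring are flat (a case of Chase's theorem). -/
lemma flat_fun {A : Type*} [CommRing A] [IsNoetherianRing A] (X : Type*) :
    Module.Flat A (X → A) := by
  apply Module.Flat.of_forall_isTrivialRelation
  intro l f x h
  let φ : (Fin l → A) →ₗ[A] A := Fintype.linearCombination A f
  have hφ : ∀ v : Fin l → A, φ v = ∑ i, f i * v i := by
    intro v
    simp [φ, Fintype.linearCombination_apply, mul_comm]
  obtain ⟨k, g, hg⟩ := Submodule.fg_iff_exists_fin_generating_family.mp
    (IsNoetherian.noetherian (LinearMap.ker φ))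
  have hx : ∀ p : X, ∃ c : Fin k → A, ∑ j, c j • g j = fun i => x i p := by
    intro p
    rw [← Submodule.mem_span_range_iff_exists_fun, hg, LinearMap.mem_ker, hφ]
    simpa using congrFun h p
  choose c hc using hx
  refine ⟨k, fun i j => g j i, fun j p => c p j, ?_, ?_⟩
  · intro i
    funext p
    have := congrFun (hc p) i
    simp only [Finset.sum_apply, Pi.smul_apply, smul_eq_mul] at this ⊢
    rw [← this]
    exact Finset.sum_congr rfl fun j _ => mul_comm _ _
  · intro j
    rw [← hφ, ← LinearMap.mem_ker, ← hg]
    exact Submodule.subset_span ⟨j, rfl⟩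

/-- local description of flatly embedded families. Let `A` be Noetherian
and `I ⊆ S_A` an ideal with `B = S_A/I` finitely generated and flat over `A`. If
`F ∈ P_A` generates `Hom_A(B, A) = {f ∈ P_A : f(I) = 0}` as an `S_A`-module, then
`I = Ann(F)` (so `B = Apolar(F)`), `S_A ≅ Ann(F) ⊕ Apolar(F)` as `A`-modules, there is a
short exact sequence `0 → S_A·F → P_A → Hom_A(Ann(F), A) → 0` (the second map being
restriction of functionals), and `P_A/(S_A·F) ≅ Hom_A(Ann(F), A)` is flat over `A`, i.e.
the apolar family `Spec Apolar(F) → Spec A` is flatly embedded. -/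
theorem generator_of_dualizing_module_gives_flat_embedding
    {A : Type*} [CommRing A] [IsNoetherianRing A] {n : ℕ}
    (I : Ideal (MvPolynomial (Fin n) A))
    (hfin : Module.Finite A (MvPolynomial (Fin n) A ⧸ I))
    (hflat : Module.Flat A (MvPolynomial (Fin n) A ⧸ I))
    (F : Module.Dual A (MvPolynomial (Fin n) A))
    (hgen : SAF F =
      ⨅ σ ∈ I, LinearMap.ker ((LinearMap.applyₗ σ :
        Module.Dual A (MvPolynomial (Fin n) A) →ₗ[A] A))) :
    I = annRel F ∧
    Nonempty ((MvPolynomial (Fin n) A) ≃ₗ[A]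
      ↥(Submodule.restrictScalars A (annRel F)) × (MvPolynomial (Fin n) A ⧸ annRel F)) ∧
    Function.Surjective
      (LinearMap.dualMap ((Submodule.restrictScalars A (annRel F)).subtype)) ∧
    LinearMap.ker
        (LinearMap.dualMap ((Submodule.restrictScalars A (annRel F)).subtype)) = SAF F ∧
    Nonempty ((Module.Dual A (MvPolynomial (Fin n) A) ⧸ SAF F) ≃ₗ[A]
      Module.Dual A ↥(Submodule.restrictScalars A (annRel F))) ∧
    Module.Flat A (Module.Dual A (MvPolynomial (Fin n) A) ⧸ SAF F) := by
  have hproj : Module.Projective A (MvPolynomial (Fin n) A ⧸ I) :=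
    have := Module.finitePresentation_of_finite A (MvPolynomial (Fin n) A ⧸ I)
    Module.Flat.projective_of_finitePresentation
  have hmem : ∀ f, f ∈ SAF F ↔ ∀ σ ∈ I, f σ = 0 := by
    intro f
    rw [hgen]
    simp [Submodule.mem_iInf]
  have hann : ∀ σ, σ ∈ annRel F ↔ ∀ τ, F (σ * τ) = 0 := by
    intro σ
    constructor
    · intro h τ
      exact LinearMap.congr_fun (show pact σ F = 0 from h) τ
    · intro h
      exact LinearMap.ext h
  have hI : I = annRel F := by
    apply le_antisymm
    · intro σ hσ
      rw [hann]
      intro τ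
      have hF : F ∈ SAF F := ⟨1, by
        apply LinearMap.ext
        intro ρ
        show F (1 * ρ) = F ρ
        rw [one_mul]⟩
      exact (hmem F).1 hF _ (I.mul_mem_right _ hσ)
    · intro σ hσ
      rw [← Ideal.Quotient.eq_zero_iff_mem, ← Module.forall_dual_apply_eq_zero_iff A]
      intro f
      have hf : f ∘ₗ (Ideal.Quotient.mkₐ A I).toLinearMap ∈ SAF F := by
        rw [hmem]
        intro ρ hρ
        show f (Ideal.Quotient.mk I ρ) = 0
        rw [Ideal.Quotient.eq_zero_iff_mem.2 hρ, map_zero]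
      obtain ⟨τ, hτ⟩ := hf
      have h2 : F (τ * σ) = f (Ideal.Quotient.mk I σ) := LinearMap.congr_fun hτ σ
      rw [← h2, mul_comm]
      exact (hann σ).1 hσ τ
  refine ⟨hI, ?_⟩
  clear hgen
  generalize hJ : annRel F = J at hI
  subst hI
  let q : MvPolynomial (Fin n) A →ₗ[A] MvPolynomial (Fin n) A ⧸ I :=
    (Ideal.Quotient.mkₐ A I).toLinearMap
  have hq : Function.Surjective q := Ideal.Quotient.mk_surjective
  have hq0 : ∀ x, q x = 0 ↔ x ∈ I := fun x => Ideal.Quotient.eq_zero_iff_mem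
  obtain ⟨s, hs⟩ := Module.projective_lifting_property q LinearMap.id hq
  have hs' : ∀ x, q (s x) = x := fun x => LinearMap.congr_fun hs x
  let r : MvPolynomial (Fin n) A →ₗ[A] ↥(Submodule.restrictScalars A I) :=
    LinearMap.codRestrict _ (LinearMap.id - s ∘ₗ q) (by
      intro x
      show x - s (q x) ∈ I
      rw [← hq0, map_sub, hs', sub_self])
  have hr : ∀ x, (r x : MvPolynomial (Fin n) A) = x - s (q x) := fun x => rfl
  have hri : r ∘ₗ (Submodule.restrictScalars A I).subtype = LinearMap.id := by
    apply LinearMap.ext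
    rintro ⟨x, hx⟩
    apply Subtype.ext
    show (r x : MvPolynomial (Fin n) A) = x
    rw [hr, (hq0 x).2 hx, map_zero, sub_zero]
  have hdual : LinearMap.dualMap (Submodule.restrictScalars A I).subtype ∘ₗ LinearMap.dualMap r
      = LinearMap.id := by
    rw [LinearMap.dualMap_comp_dualMap, hri, LinearMap.dualMap_id]
  have hsurj : Function.Surjective
      (LinearMap.dualMap (Submodule.restrictScalars A I).subtype) :=
    fun g => ⟨LinearMap.dualMap r g, LinearMap.congr_fun hdual g⟩
  have hker : LinearMap.ker
      (LinearMap.dualMap (Submodule.restrictScalars A I).subtype) = SAF F := by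
    ext f
    rw [hmem, LinearMap.mem_ker]
    constructor
    · intro h σ hσ
      exact LinearMap.congr_fun h ⟨σ, hσ⟩
    · intro h
      apply LinearMap.ext
      rintro ⟨σ, hσ⟩
      exact h σ hσ
  let e : (Module.Dual A (MvPolynomial (Fin n) A) ⧸ SAF F) ≃ₗ[A]
      Module.Dual A ↥(Submodule.restrictScalars A I) :=
    (Submodule.quotEquivOfEq _ _ hker.symm).trans (LinearMap.quotKerEquivOfSurjective _ hsurj)
  refine ⟨⟨LinearEquiv.ofBijective (r.prod q) ⟨?_, ?_⟩⟩, hsurj, hker, ⟨e⟩, ?_⟩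
  · rw [← LinearMap.ker_eq_bot, LinearMap.ker_eq_bot']
    intro x hx
    have h1 : r x = 0 := congrArg Prod.fst hx
    have h2 : q x = 0 := congrArg Prod.snd hx
    have h3 := hr x
    rw [h1, h2, map_zero, sub_zero] at h3
    exact h3.symm
  · rintro ⟨⟨x, hx⟩, y⟩
    have hx0 : q x = 0 := (hq0 x).2 hx
    have h2 : q (x + s y) = y := by rw [map_add, hs', hx0, zero_add]
    refine ⟨x + s y, Prod.ext (Subtype.ext ?_) h2⟩
    show (r (x + s y) : MvPolynomial (Fin n) A) = x
    rw [hr, h2, add_sub_cancel_right]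
  · have hP : Module.Flat A (Module.Dual A (MvPolynomial (Fin n) A)) :=
      have := flat_fun (A := A) (Fin n →₀ ℕ)
      Module.Flat.of_linearEquiv
        ((MvPolynomial.basisMonomials (Fin n) A).constr (M' := A) A).symm
    have hD : Module.Flat A (Module.Dual A ↥(Submodule.restrictScalars A I)) :=
      Module.Flat.of_retract (LinearMap.dualMap r) _ hdual
    exact Module.Flat.of_linearEquiv e

end RelativeApolarity
end
end

section
/- Let A be a commutative Noetherian ring and F ∈ P_A such that Apolar(F) is finitely generated as an A-module and the apolar family is flatly embedded, i.e., P_A/(S_A·F) is a flat A-module. Then for every ring homomorphism φ : A → B, the natural map B ⊗_A (S_A·F) → P_B is injective with image S_B·F_B; consequently B ⊗_A Apolar(F) ≅ Apolar(F_B) as B-algebras. In particular, for every prime t of A the fiber of Spec Apolar(F) → Spec A over t is Spec Apolar(F_t), and the function t ↦ dim_{κ(t)} Apolar(F_t) is locally constant on Spec A. -/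
noncomputable section

open MvPolynomial TensorProduct

namespace RelativeApolarity

variable {A : Type*} [CommRing A] {n : ℕ}

/-- The residue field `κ(p)` of a prime `p`. -/
def resField {A : Type*} [CommRing A] (p : PrimeSpectrum A) : Type _ :=
  IsLocalRing.ResidueField (Localization.AtPrime p.asIdeal)

noncomputable instance {A : Type*} [CommRing A] (p : PrimeSpectrum A) :
    Field (resField p) :=
  inferInstanceAs (Field (IsLocalRing.ResidueField (Localization.AtPrime p.asIdeal)))

/-- The canonical map `A → κ(p)` as an algebra structure. -/
noncomputable instance {A : Type*} [CommRing A] (p : PrimeSpectrum A) :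
    Algebra A (resField p) :=
  ((algebraMap (Localization.AtPrime p.asIdeal)
      (IsLocalRing.ResidueField (Localization.AtPrime p.asIdeal))).comp
    (algebraMap A (Localization.AtPrime p.asIdeal))).toAlgebra

/-- `M ⊗ P_A → M^{monomials}` is injective for every `A`-module `M` (`A` Noetherian). -/
lemma tensor_dual_eq_zero [IsNoetherianRing A] {M : Type*} [AddCommGroup M] [Module A M]
    (z : M ⊗[A] Module.Dual A (MvPolynomial (Fin n) A))
    (hz : ∀ m : Fin n →₀ ℕ,
      TensorProduct.rid A M ((LinearMap.applyₗ (MvPolynomial.monomial m (1 : A)) :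
        Module.Dual A (MvPolynomial (Fin n) A) →ₗ[A] A).lTensor M z) = 0) : z = 0 := by
  obtain ⟨k, m, f, rfl⟩ := TensorProduct.exists_sum_tmul_eq z
  let G : (Fin k → A) →ₗ[A] M := Fintype.linearCombination A m
  obtain ⟨r, g, hg⟩ := Submodule.fg_iff_exists_fin_generating_family.mp
    (IsNoetherian.noetherian (LinearMap.ker G))
  have h1 : ∀ i : Fin n →₀ ℕ, ∃ c : Fin r → A,
      ∑ l, c l • g l = fun j => f j (MvPolynomial.monomial i 1) := by
    intro i
    have : (fun j => f j (MvPolynomial.monomial i 1)) ∈ LinearMap.ker G := by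
      have := hz i
      simpa [G, Fintype.linearCombination_apply] using this
    rw [← hg] at this
    exact (Submodule.mem_span_range_iff_exists_fun A).mp this
  choose c hc using h1
  apply TensorProduct.sum_tmul_eq_zero_of_vanishesTrivially
  refine ⟨r, fun j l => g l j,
    fun l => (MvPolynomial.basisMonomials (Fin n) A).constr A (fun i => c i l), ?_, ?_⟩
  · intro j
    apply (MvPolynomial.basisMonomials (Fin n) A).ext
    intro i
    have := congrFun (hc i) j
    rw [LinearMap.sum_apply]
    simp only [LinearMap.smul_apply, MvPolynomial.coe_basisMonomials]
    rw [← this]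
    simp only [Finset.sum_apply, Pi.smul_apply, smul_eq_mul]
    refine Finset.sum_congr rfl fun l _ => ?_
    have h2 := (MvPolynomial.basisMonomials (Fin n) A).constr_basis A (fun i => c i l) i
    rw [MvPolynomial.coe_basisMonomials] at h2
    rw [h2, mul_comm]
  · intro l
    have : g l ∈ LinearMap.ker G := hg ▸ Submodule.subset_span ⟨l, rfl⟩
    simpa [G, Fintype.linearCombination_apply] using this

lemma lTensor_subtype_injective_aux {P : Type*} [AddCommGroup P] [Module A P]
    (N : Submodule A P) (hflat : Module.Flat A (P ⧸ N))
    (M : Type*) [AddCommGroup M] [Module A M] :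
    Function.Injective (N.subtype.lTensor M) :=
  LinearMap.lTensor_injective_of_exact_of_flat N.mkQ (Submodule.mkQ_surjective _)
    N.subtype (Submodule.subtype_injective _) (LinearMap.exact_subtype_mkQ _) M

lemma flat_submodule_aux {P : Type*} [AddCommGroup P] [Module A P] (N : Submodule A P)
    (h : ∀ J : Ideal A, Function.Injective (J.subtype.rTensor N)) : Module.Flat A N :=
  Module.Flat.iff_rTensor_injective'.mpr h

lemma lTensor_SAF_injective (F : Module.Dual A (MvPolynomial (Fin n) A))
    (hflat : Module.Flat A (Module.Dual A (MvPolynomial (Fin n) A) ⧸ SAF F))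
    (M : Type*) [AddCommGroup M] [Module A M] :
    Function.Injective ((SAF F).subtype.lTensor M) :=
  lTensor_subtype_injective_aux (SAF F) hflat M

lemma SAF_flat [IsNoetherianRing A] (F : Module.Dual A (MvPolynomial (Fin n) A))
    (hflat : Module.Flat A (Module.Dual A (MvPolynomial (Fin n) A) ⧸ SAF F)) :
    Module.Flat A (SAF F) := by
  apply flat_submodule_aux (SAF F)
  intro J
  rw [injective_iff_map_eq_zero]
  intro x hx
  apply (injective_iff_map_eq_zero _).mp (lTensor_SAF_injective F hflat J)
  apply tensor_dual_eq_zero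
  intro m
  apply Subtype.val_injective
  have key : ∀ y : J ⊗[A] SAF F,
      ((TensorProduct.rid A J ((LinearMap.applyₗ (MvPolynomial.monomial m (1 : A)) :
        Module.Dual A (MvPolynomial (Fin n) A) →ₗ[A] A).lTensor J
          ((SAF F).subtype.lTensor J y)) : J) : A) =
      (TensorProduct.lid A (SAF F) (J.subtype.rTensor (SAF F) y) : Module.Dual A _)
        (MvPolynomial.monomial m (1 : A)) := by
    intro y
    induction y with
    | zero => simp
    | tmul a b => simp [mul_comm]
    | add a b ha hb => simp only [map_add, Submodule.coe_add, ha, hb, LinearMap.add_apply]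
  rw [key, hx]
  simp

lemma dualBC_monomial (B : Type*) [CommRing B] [Algebra A B]
    (f : Module.Dual A (MvPolynomial (Fin n) A)) (m : Fin n →₀ ℕ) :
    dualBC B f (MvPolynomial.monomial m 1) =
      algebraMap A B (f (MvPolynomial.monomial m 1)) := by
  have h2 := (MvPolynomial.basisMonomials (Fin n) B).constr_basis A
    (fun m => algebraMap A B (f (MvPolynomial.monomial m 1))) m
  rw [MvPolynomial.coe_basisMonomials] at h2
  exact h2


lemma dualBC_map (B : Type*) [CommRing B] [Algebra A B]
    (f : Module.Dual A (MvPolynomial (Fin n) A)) (σ : MvPolynomial (Fin n) A) :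
    dualBC B f (MvPolynomial.map (algebraMap A B) σ) = algebraMap A B (f σ) := by
  induction σ using MvPolynomial.induction_on' with
  | monomial m a =>
    have h1 : MvPolynomial.monomial m a = a • MvPolynomial.monomial m (1 : A) := by
      rw [MvPolynomial.smul_monomial, smul_eq_mul, mul_one]
    have h2 : MvPolynomial.monomial m (algebraMap A B a) =
        algebraMap A B a • MvPolynomial.monomial m (1 : B) := by
      rw [MvPolynomial.smul_monomial, smul_eq_mul, mul_one]
    rw [MvPolynomial.map_monomial, h2, map_smul, dualBC_monomial, h1, map_smul,
      smul_eq_mul, smul_eq_mul, map_mul]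
  | add p q hp hq => simp only [map_add, hp, hq]

lemma pact_dualBC (B : Type*) [CommRing B] [Algebra A B]
    (f : Module.Dual A (MvPolynomial (Fin n) A)) (σ : MvPolynomial (Fin n) A) :
    pact (MvPolynomial.map (algebraMap A B) σ) (dualBC B f) = dualBC B (pact σ f) := by
  apply (MvPolynomial.basisMonomials (Fin n) B).ext
  intro m
  rw [MvPolynomial.coe_basisMonomials]
  change pact _ _ (MvPolynomial.monomial m 1) = dualBC B (pact σ f) (MvPolynomial.monomial m 1)
  rw [pact_apply, dualBC_monomial, pact_apply, ← dualBC_map,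
    (MvPolynomial.map (algebraMap A B)).map_mul, MvPolynomial.map_monomial,
    (algebraMap A B).map_one]

lemma ker_mk_eq (F : Module.Dual A (MvPolynomial (Fin n) A)) :
    LinearMap.ker (Ideal.Quotient.mkₐ A (annRel F)).toLinearMap = LinearMap.ker (actMap F) := by
  ext σ
  simp only [LinearMap.mem_ker, AlgHom.toLinearMap_apply, Ideal.Quotient.mkₐ_eq_mk,
    Ideal.Quotient.eq_zero_iff_mem]
  rfl

/-- `Apolar(F) ≅ S_A·F`. -/
def apolarEquiv (F : Module.Dual A (MvPolynomial (Fin n) A)) :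
    (MvPolynomial (Fin n) A ⧸ annRel F) ≃ₗ[A] SAF F :=
  ((Ideal.Quotient.mkₐ A (annRel F)).toLinearMap.quotKerEquivOfSurjective
    (Ideal.Quotient.mkₐ_surjective A _)).symm ≪≫ₗ
  Submodule.quotEquivOfEq _ (LinearMap.ker (actMap F)) (ker_mk_eq F) ≪≫ₗ
  (actMap F).quotKerEquivRange

lemma apolarEquiv_mk (F : Module.Dual A (MvPolynomial (Fin n) A)) (σ : MvPolynomial (Fin n) A) :
    (apolarEquiv F (Ideal.Quotient.mk _ σ) : Module.Dual A (MvPolynomial (Fin n) A)) =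
      pact σ F := by
  have : ((Ideal.Quotient.mkₐ A (annRel F)).toLinearMap.quotKerEquivOfSurjective
    (Ideal.Quotient.mkₐ_surjective A _)).symm (Ideal.Quotient.mk _ σ) =
      Submodule.Quotient.mk σ := by
    rw [LinearEquiv.symm_apply_eq]
    rfl
  have h2 := congrArg (fun x => (((actMap F).quotKerEquivRange
    (Submodule.quotEquivOfEq _ (LinearMap.ker (actMap F)) (ker_mk_eq F) x) : SAF F) :
      Module.Dual A (MvPolynomial (Fin n) A))) this
  exact h2

/-- The comparison map `B ⊗ Apolar(F) → Apolar(F_B)`. -/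
def compMap (B : Type*) [CommRing B] [Algebra A B] (F : Module.Dual A (MvPolynomial (Fin n) A)) :
    (B ⊗[A] (MvPolynomial (Fin n) A ⧸ annRel F)) →ₐ[B]
        (MvPolynomial (Fin n) B ⧸ annRel (dualBC B F)) :=
  Algebra.TensorProduct.lift (Algebra.ofId B _)
    (Ideal.Quotient.liftₐ (annRel F)
      ((Ideal.Quotient.mkₐ A (annRel (dualBC B F))).comp
        (MvPolynomial.mapAlgHom (Algebra.ofId A B))) (by
        intro σ hσ
        have hσ : pact σ F = 0 := hσ
        change Ideal.Quotient.mk _ (MvPolynomial.map (algebraMap A B) σ) = 0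
        rw [Ideal.Quotient.eq_zero_iff_mem]
        change pact _ _ = 0
        rw [pact_dualBC, hσ, map_zero]))
    (fun _ _ => Commute.all _ _)

lemma compMap_tmul (B : Type*) [CommRing B] [Algebra A B]
    (F : Module.Dual A (MvPolynomial (Fin n) A)) (b : B) (σ : MvPolynomial (Fin n) A) :
    compMap B F (b ⊗ₜ Ideal.Quotient.mk _ σ) =
      Ideal.Quotient.mk _ (b • MvPolynomial.map (algebraMap A B) σ) := by
  rw [MvPolynomial.smul_eq_C_mul, map_mul]
  rfl

lemma compMap_surjective (B : Type*) [CommRing B] [Algebra A B]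
    (F : Module.Dual A (MvPolynomial (Fin n) A)) : Function.Surjective (compMap B F) := by
  have h : (compMap B F).comp (MvPolynomial.aeval
      (fun i => (1 : B) ⊗ₜ[A] Ideal.Quotient.mk (annRel F) (MvPolynomial.X i))) =
      Ideal.Quotient.mkₐ B (annRel (dualBC B F)) := by
    apply MvPolynomial.algHom_ext
    intro i
    simp [compMap_tmul]
  intro y
  obtain ⟨q, rfl⟩ := Ideal.Quotient.mkₐ_surjective B _ y
  exact ⟨_, DFunLike.congr_fun h q⟩

lemma apolarEquiv_compMap (B : Type*) [CommRing B] [Algebra A B]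
    (F : Module.Dual A (MvPolynomial (Fin n) A))
    (z : B ⊗[A] (MvPolynomial (Fin n) A ⧸ annRel F)) :
    (apolarEquiv (dualBC B F) (compMap B F z) : Module.Dual B (MvPolynomial (Fin n) B)) =
      LinearMap.liftBaseChange B ((dualBC B).comp (SAF F).subtype)
        ((apolarEquiv F).lTensor B z) := by
  induction z with
  | zero => simp
  | tmul b s =>
    obtain ⟨σ, rfl⟩ := Ideal.Quotient.mk_surjective s
    rw [compMap_tmul, apolarEquiv_mk, pact_smul, pact_dualBC, LinearEquiv.lTensor_tmul,
      LinearMap.liftBaseChange_tmul, LinearMap.comp_apply, Submodule.subtype_apply,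
      apolarEquiv_mk]
  | add x y hx hy => simp only [map_add, Submodule.coe_add, hx, hy]

lemma liftBC_injective [IsNoetherianRing A] (F : Module.Dual A (MvPolynomial (Fin n) A))
    (hflat : Module.Flat A (Module.Dual A (MvPolynomial (Fin n) A) ⧸ SAF F))
    (B : Type*) [CommRing B] [Algebra A B] :
    Function.Injective (LinearMap.liftBaseChange B ((dualBC B).comp (SAF F).subtype)) := by
  rw [injective_iff_map_eq_zero]
  intro x hx
  apply (injective_iff_map_eq_zero _).mp (lTensor_SAF_injective F hflat B)
  apply tensor_dual_eq_zero
  intro m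
  have key : ∀ y : B ⊗[A] SAF F,
      TensorProduct.rid A B ((LinearMap.applyₗ (MvPolynomial.monomial m (1 : A)) :
        Module.Dual A (MvPolynomial (Fin n) A) →ₗ[A] A).lTensor B
          ((SAF F).subtype.lTensor B y)) =
      LinearMap.liftBaseChange B ((dualBC B).comp (SAF F).subtype) y
        (MvPolynomial.monomial m (1 : B)) := by
    intro y
    induction y with
    | zero => simp
    | tmul a b =>
      rw [LinearMap.liftBaseChange_tmul, LinearMap.smul_apply, LinearMap.comp_apply,
        dualBC_monomial]
      simp [Algebra.smul_def, mul_comm]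
    | add a b ha hb => simp only [map_add, ha, hb, LinearMap.add_apply]
  rw [key, hx]
  simp

lemma base_change_aux [IsNoetherianRing A] (F : Module.Dual A (MvPolynomial (Fin n) A))
    (hflat : Module.Flat A (Module.Dual A (MvPolynomial (Fin n) A) ⧸ SAF F))
    (B : Type*) [CommRing B] [Algebra A B] :
      Function.Injective
        (LinearMap.liftBaseChange B ((dualBC B).comp (SAF F).subtype)) ∧
      LinearMap.range (LinearMap.liftBaseChange B ((dualBC B).comp (SAF F).subtype)) =
        SAF (dualBC B F) ∧
      Nonempty ((B ⊗[A] (MvPolynomial (Fin n) A ⧸ annRel F)) ≃ₐ[B]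
        (MvPolynomial (Fin n) B ⧸ annRel (dualBC B F))) := by
  have hinj := liftBC_injective F hflat B
  refine ⟨hinj, ?_, ⟨AlgEquiv.ofBijective (compMap B F) ⟨?_, compMap_surjective B F⟩⟩⟩
  · ext y
    constructor
    · rintro ⟨x, rfl⟩
      obtain ⟨z, rfl⟩ := ((apolarEquiv F).lTensor B).surjective x
      rw [← apolarEquiv_compMap]
      exact Subtype.property _
    · intro hy
      obtain ⟨w, hw⟩ := (apolarEquiv (dualBC B F)).surjective ⟨y, hy⟩
      obtain ⟨z, rfl⟩ := compMap_surjective B F w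
      exact ⟨_, (apolarEquiv_compMap B F z).symm.trans (congrArg Subtype.val hw)⟩
  · intro x y hxy
    apply ((apolarEquiv F).lTensor B).injective
    apply hinj
    rw [← apolarEquiv_compMap, ← apolarEquiv_compMap, hxy]

lemma finrank_congr_algebra {M : Type*} [AddCommGroup M] [Module A M] (k : Type*) [Field k]
    (i₁ i₂ : Algebra A k)
    (h : ∀ a, @algebraMap A k _ _ i₁ a = @algebraMap A k _ _ i₂ a) :
    (letI := i₁; Module.finrank k (k ⊗[A] M)) = (letI := i₂; Module.finrank k (k ⊗[A] M)) := by
  have : i₁ = i₂ := Algebra.algebra_ext _ _ h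
  subst this
  rfl

/-- Let `A` be Noetherian and `F ∈ P_A` with `Apolar(F)` finitely
generated over `A` and the apolar family flatly embedded, i.e. `P_A/(S_A·F)` flat. Then
for every `A`-algebra `B` the natural map `B ⊗_A (S_A·F) → P_B` is injective with image
`S_B·F_B`, and `B ⊗_A Apolar(F) ≅ Apolar(F_B)` as `B`-algebras. In particular the fibre
of the apolar family over a prime `t` is `Spec Apolar(F_t)` and
`t ↦ dim_{κ(t)} Apolar(F_t)` is locally constant on `Spec A`. -/
theorem base_change_of_flatly_embedded_apolar_family
    {A : Type*} [CommRing A] [IsNoetherianRing A] {n : ℕ}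
    (F : Module.Dual A (MvPolynomial (Fin n) A))
    (hfin : Module.Finite A (MvPolynomial (Fin n) A ⧸ annRel F))
    (hflat : Module.Flat A (Module.Dual A (MvPolynomial (Fin n) A) ⧸ SAF F)) :
    (∀ (B : Type*) [CommRing B] [Algebra A B],
      Function.Injective
        (LinearMap.liftBaseChange B ((dualBC B).comp (SAF F).subtype)) ∧
      LinearMap.range (LinearMap.liftBaseChange B ((dualBC B).comp (SAF F).subtype)) =
        SAF (dualBC B F) ∧
      Nonempty ((B ⊗[A] (MvPolynomial (Fin n) A ⧸ annRel F)) ≃ₐ[B]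
        (MvPolynomial (Fin n) B ⧸ annRel (dualBC B F)))) ∧
    IsLocallyConstant (fun p : PrimeSpectrum A =>
      Module.finrank (resField p)
        (MvPolynomial (Fin n) (resField p) ⧸ annRel (dualBC (resField p) F))) := by
  refine ⟨fun B _ _ => base_change_aux F hflat B, ?_⟩
  have := SAF_flat F hflat
  have : Module.Flat A (MvPolynomial (Fin n) A ⧸ annRel F) :=
    Module.Flat.of_linearEquiv (apolarEquiv F)
  have : Module.FinitePresentation A (MvPolynomial (Fin n) A ⧸ annRel F) :=
    Module.finitePresentation_of_finite A _
  have h := Module.isLocallyConstant_rankAtStalk (R := A)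
    (M := MvPolynomial (Fin n) A ⧸ annRel F)
  convert h using 1
  funext p
  obtain ⟨-, -, ⟨e⟩⟩ := base_change_aux F hflat (resField p)
  rw [← e.toLinearEquiv.finrank_eq, Module.rankAtStalk_eq]
  exact finrank_congr_algebra (M := MvPolynomial (Fin n) A ⧸ annRel F)
    p.asIdeal.ResidueField _ _ (fun a => by
      exact (IsScalarTower.algebraMap_apply A (Localization.AtPrime p.asIdeal)
        p.asIdeal.ResidueField a).symm)

end RelativeApolarity
end
end

section
/- Let W be the 56-dimensional complex vector space of homogeneous cubic forms in six variables x₁,…,x₆, with SL₆(ℂ) acting by linear substitution of variables: (g·f)(x) = f(g⁻¹x). If Φ : W → ℂ is a polynomial function which is homogeneous of degree d with 1 ≤ d ≤ 9 and satisfies Φ(g·f) = Φ(f) for all g ∈ SL₆(ℂ) and all f ∈ W, then Φ = 0. Equivalently, there are no nonzero SL₆(ℂ)-invariant elements in Sym^d(Sym³(ℂ⁶)^*)^* for 1 ≤ d ≤ 9. -/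
noncomputable section

open MvPolynomial

namespace SLInvariants

/-- Exponent vectors of degree `3`: the coordinates on the space `W = Sym³(ℂ⁶)^*` of
cubic forms in six variables are the coefficients indexed by these monomials. -/
abbrev CubicMonomial : Type := {m : Fin 6 →₀ ℕ // (m.sum fun _ k => k) = 3}

/-- The substitution action of `g ∈ SL₆(ℂ)` on polynomials in six variables:
`(g·f)(x) = f(g⁻¹x)`. -/
def slAct (g : Matrix.SpecialLinearGroup (Fin 6) ℂ) (f : MvPolynomial (Fin 6) ℂ) :
    MvPolynomial (Fin 6) ℂ :=
  MvPolynomial.aeval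
    (fun i : Fin 6 =>
      ∑ j : Fin 6,
        ((g⁻¹ : Matrix.SpecialLinearGroup (Fin 6) ℂ) : Matrix (Fin 6) (Fin 6) ℂ) i j •
          (X j : MvPolynomial (Fin 6) ℂ)) f

/-- Evaluation of a polynomial function `Φ` in the coefficients of cubic forms at the
cubic form `f`. -/
def evalAtCubic (Φ : MvPolynomial CubicMonomial ℂ) (f : MvPolynomial (Fin 6) ℂ) : ℂ :=
  MvPolynomial.eval (fun m : CubicMonomial => MvPolynomial.coeff m.1 f) Φ


/-! ### Polarization -/

theorem eval_smul_of_homog {σ : Type*} (Φ : MvPolynomial σ ℂ) (d : ℕ) (h : Φ.IsHomogeneous d)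
    (t : ℂ) (w : σ → ℂ) : eval (t • w) Φ = t ^ d * eval w Φ := by
  rw [MvPolynomial.eval_eq, MvPolynomial.eval_eq, Finset.mul_sum]
  refine Finset.sum_congr rfl fun m hm => ?_
  have hd : ∑ i ∈ m.support, m i = d := by
    have := h (MvPolynomial.mem_support_iff.1 hm)
    rw [Finsupp.weight_apply] at this
    simpa [Finsupp.sum] using this
  simp only [Pi.smul_apply, smul_eq_mul, mul_pow, Finset.prod_mul_distrib]
  rw [Finset.prod_pow_eq_pow_sum, hd]
  ring

theorem contDiff_eval {σ : Type*} [Fintype σ] (Φ : MvPolynomial σ ℂ) :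
    ContDiff ℂ ⊤ (fun w : σ → ℂ => eval w Φ) := by
  induction Φ using MvPolynomial.induction_on with
  | C a => simpa using contDiff_const
  | add p q hp hq => simpa using hp.add hq
  | mul_X p i hp => simpa using hp.mul (contDiff_apply ℂ ℂ i)

theorem exists_polar {σ : Type*} [Fintype σ] (Φ : MvPolynomial σ ℂ) (d : ℕ)
    (h : Φ.IsHomogeneous d) :
    ∃ M : MultilinearMap ℂ (fun _ : Fin d => (σ → ℂ)) ℂ,
      (∀ (π : Equiv.Perm (Fin d)) v, M (fun i => v (π i)) = M v) ∧
      (∀ L : (σ → ℂ) →ₗ[ℂ] (σ → ℂ), (∀ w, eval (L w) Φ = eval w Φ) →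
        ∀ v, M (fun i => L (v i)) = M v) ∧
      ∀ w, M (fun _ => w) = (d.factorial : ℂ) * eval w Φ := by
  have hc := contDiff_eval Φ
  refine ⟨(iteratedFDeriv ℂ d (fun w : σ → ℂ => eval w Φ) 0).toMultilinearMap, ?_, ?_, ?_⟩
  · intro π v
    exact (hc.contDiffAt.of_le le_top).iteratedFDeriv_comp_perm v π
  · intro L hL v
    have h1 := ContinuousLinearMap.iteratedFDeriv_comp_right (LinearMap.toContinuousLinearMap L)
      hc 0 (i := d) (by exact le_top)
    have h2 : (fun w : σ → ℂ => eval w Φ) ∘ (LinearMap.toContinuousLinearMap L) =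
        fun w : σ → ℂ => eval w Φ := by
      funext w; exact hL w
    rw [h2, map_zero] at h1
    have h3 := congrArg (fun F => F v) h1
    exact h3.symm
  · intro w
    have h1 := ContinuousLinearMap.iteratedFDeriv_comp_right
      ((ContinuousLinearMap.id ℂ ℂ).smulRight w) hc 0 (i := d) (by exact le_top)
    have h2 : (fun w : σ → ℂ => eval w Φ) ∘ ((ContinuousLinearMap.id ℂ ℂ).smulRight w) =
        fun t : ℂ => eval w Φ * t ^ d := by
      funext t
      simp [eval_smul_of_homog Φ d h, mul_comm]
    rw [h2, map_zero] at h1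
    have h3 := congrArg (fun F => F (fun _ => 1)) h1
    simp only [iteratedFDeriv_apply_eq_iteratedDeriv_mul_prod] at h3
    have h4 : iteratedDeriv d (fun t : ℂ => eval w Φ * t ^ d) 0 = d.factorial * eval w Φ := by
      rw [iteratedDeriv_const_mul_field, iteratedDeriv_fun_pow_zero]
      simp [mul_comm]
    rw [h4] at h3
    simp at h3
    exact h3.symm

/-! ### Coefficients of cubic forms -/

instance : Finite CubicMonomial := by
  have hle : ∀ (m : CubicMonomial) (i : Fin 6), m.1 i < 4 := by
    intro m i
    have h := m.2
    rw [Finsupp.sum_fintype _ _ (fun _ => rfl)] at h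
    have := Finset.single_le_sum (f := fun i => m.1 i) (fun _ _ => Nat.zero_le _)
      (Finset.mem_univ i)
    omega
  refine Finite.of_injective (β := Fin 6 → Fin 4) (fun m i => ⟨m.1 i, hle m i⟩) ?_
  intro m n h
  apply Subtype.ext
  ext i
  have := congrFun h i
  simpa using this

instance : Fintype CubicMonomial := Fintype.ofFinite _

/-- The coefficient vector of a cubic form. -/
def coeffs : MvPolynomial (Fin 6) ℂ →ₗ[ℂ] (CubicMonomial → ℂ) :=
  LinearMap.pi fun m => MvPolynomial.lcoeff ℂ m.1

/-- The cubic form with a given coefficient vector. -/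
def ofCoeffs : (CubicMonomial → ℂ) →ₗ[ℂ] MvPolynomial (Fin 6) ℂ :=
  ∑ m : CubicMonomial, (MvPolynomial.monomial m.1).comp (LinearMap.proj m)

theorem coeffs_apply (f : MvPolynomial (Fin 6) ℂ) (m : CubicMonomial) :
    coeffs f m = coeff m.1 f := rfl

theorem ofCoeffs_apply (w : CubicMonomial → ℂ) :
    ofCoeffs w = ∑ m : CubicMonomial, monomial m.1 (w m) := by
  simp [ofCoeffs]

theorem coeffs_ofCoeffs (w : CubicMonomial → ℂ) : coeffs (ofCoeffs w) = w := by
  classical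
  funext m
  rw [coeffs_apply, ofCoeffs_apply, coeff_sum]
  simp [coeff_monomial, Subtype.ext_iff.symm]

theorem isHomogeneous_iff_sum (m : Fin 6 →₀ ℕ) :
    Finsupp.weight 1 m = m.sum fun _ k => k := by
  rw [Finsupp.weight_apply]
  simp [Finsupp.sum]

theorem ofCoeffs_hom (w : CubicMonomial → ℂ) : (ofCoeffs w).IsHomogeneous 3 := by
  rw [ofCoeffs_apply]
  refine IsHomogeneous.sum _ _ _ fun m _ => isHomogeneous_monomial _ ?_
  have := m.2
  exact this

theorem ofCoeffs_coeffs (f : MvPolynomial (Fin 6) ℂ) (hf : f.IsHomogeneous 3) :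
    ofCoeffs (coeffs f) = f := by
  ext m
  by_cases hm : (m.sum fun _ k => k) = 3
  · exact congrFun (coeffs_ofCoeffs (coeffs f)) ⟨m, hm⟩
  · have key : ∀ g : MvPolynomial (Fin 6) ℂ, g.IsHomogeneous 3 → coeff m g = 0 := by
      intro g hg
      by_contra hne
      exact hm ((isHomogeneous_iff_sum m).symm.trans (hg hne))
    rw [key f hf, key _ (ofCoeffs_hom _)]

/-- Substitution by a matrix, as an algebra homomorphism. -/
def subst (A : Matrix (Fin 6) (Fin 6) ℂ) : MvPolynomial (Fin 6) ℂ →ₐ[ℂ] MvPolynomial (Fin 6) ℂ :=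
  MvPolynomial.aeval (fun i : Fin 6 => ∑ j : Fin 6, A i j • (X j : MvPolynomial (Fin 6) ℂ))

theorem slAct_eq (g : Matrix.SpecialLinearGroup (Fin 6) ℂ) (f : MvPolynomial (Fin 6) ℂ) :
    slAct g f = subst ((g⁻¹ : Matrix.SpecialLinearGroup (Fin 6) ℂ) :
      Matrix (Fin 6) (Fin 6) ℂ) f := rfl

/-- The linear form with a given coefficient vector. -/
def lin : (Fin 6 → ℂ) →ₗ[ℂ] MvPolynomial (Fin 6) ℂ :=
  Fintype.linearCombination ℂ (fun j : Fin 6 => (X j : MvPolynomial (Fin 6) ℂ))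

theorem lin_apply (a : Fin 6 → ℂ) : lin a = ∑ j, a j • (X j : MvPolynomial (Fin 6) ℂ) := by
  simp [lin, Fintype.linearCombination_apply]

theorem lin_single (i : Fin 6) : lin (Pi.single i 1) = X i := by
  simp [lin_apply, Pi.single_apply]

theorem lin_hom (a : Fin 6 → ℂ) : (lin a).IsHomogeneous 1 := by
  rw [lin_apply]
  refine IsHomogeneous.sum _ _ _ fun j _ => ?_
  rw [MvPolynomial.smul_eq_C_mul]
  exact (isHomogeneous_C _ _).mul (isHomogeneous_X _ _)

theorem subst_lin (A : Matrix (Fin 6) (Fin 6) ℂ) (a : Fin 6 → ℂ) :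
    subst A (lin a) = lin (Matrix.vecMul a A) := by
  simp only [lin_apply, subst, map_sum, map_smul, aeval_X, Finset.smul_sum, Matrix.vecMul,
    dotProduct, Finset.sum_smul, smul_smul]
  rw [Finset.sum_comm]

/-- A product of three linear forms. -/
def q (a : Fin 3 → Fin 6 → ℂ) : MvPolynomial (Fin 6) ℂ := ∏ k, lin (a k)

theorem q_hom (a : Fin 3 → Fin 6 → ℂ) : (q a).IsHomogeneous 3 := by
  have := IsHomogeneous.prod Finset.univ (fun k => lin (a k)) (fun _ => 1)
    (fun k _ => lin_hom (a k))
  simpa [q] using this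

theorem subst_q (A : Matrix (Fin 6) (Fin 6) ℂ) (a : Fin 3 → Fin 6 → ℂ) :
    subst A (q a) = q (fun k => Matrix.vecMul (a k) A) := by
  simp [q, map_prod, subst_lin]

theorem q_smul (c : Fin 3 → ℂ) (a : Fin 3 → Fin 6 → ℂ) :
    q (fun k => c k • a k) = (∏ k, c k) • q a := by
  simp [q, map_smul, Finset.prod_smul]

theorem hom_mem_span (f : MvPolynomial (Fin 6) ℂ) (hf : f.IsHomogeneous 3) :
    f ∈ Submodule.span ℂ (Set.range fun a : Fin 6 → ℂ => q (fun _ => a)) := by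
  set S := Submodule.span ℂ (Set.range fun a : Fin 6 → ℂ => q (fun _ => a)) with hS
  have hcube : ∀ a, (lin a) ^ 3 ∈ S := fun a =>
    Submodule.subset_span ⟨a, by simp [q, Finset.prod_const]⟩
  have htri : ∀ a b c, lin a * lin b * lin c ∈ S := by
    intro a b c
    have h6 : lin a * lin b * lin c = (1 / 6 : ℂ) • (lin (a + b + c) ^ 3 - lin (a + b) ^ 3
        - lin (a + c) ^ 3 - lin (b + c) ^ 3 + lin a ^ 3 + lin b ^ 3 + lin c ^ 3) := by
      have : lin (a + b + c) ^ 3 - lin (a + b) ^ 3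
        - lin (a + c) ^ 3 - lin (b + c) ^ 3 + lin a ^ 3 + lin b ^ 3 + lin c ^ 3
        = (6 : ℂ) • (lin a * lin b * lin c) := by
        rw [MvPolynomial.smul_eq_C_mul, show (C (6 : ℂ) : MvPolynomial (Fin 6) ℂ) = 6 from
          map_ofNat _ 6]
        simp only [map_add]
        ring
      rw [this, smul_smul]
      norm_num
    rw [h6]
    refine S.smul_mem _ ?_
    refine S.add_mem (S.add_mem (S.add_mem (S.sub_mem (S.sub_mem (S.sub_mem ?_ ?_) ?_) ?_) ?_) ?_)
      ?_ <;> apply hcube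
  have hmono : ∀ m : Fin 6 →₀ ℕ, (m.sum fun _ k => k) = 3 →
      (monomial m (1 : ℂ)) ∈ S := by
    intro m hm
    have hcard : Multiset.card (Finsupp.toMultiset m) = 3 := by
      rw [Finsupp.card_toMultiset]; exact hm
    obtain ⟨i, j, k, hijk⟩ := Multiset.card_eq_three.1 hcard
    have : monomial m (1 : ℂ) = X i * X j * X k := by
      have hm' : m = Multiset.toFinsupp {i, j, k} := by
        rw [← hijk]; simp
      rw [hm']
      have : ({i, j, k} : Multiset (Fin 6)) = {i} + {j} + {k} := rfl
      rw [this, map_add, map_add]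
      simp [Multiset.toFinsupp_singleton, X, monomial_mul]
    rw [this, ← lin_single, ← lin_single, ← lin_single]
    exact htri _ _ _
  rw [← ofCoeffs_coeffs f hf, ofCoeffs_apply]
  refine S.sum_mem fun m _ => ?_
  have : monomial m.1 (coeffs f m) = (coeffs f m) • monomial m.1 (1 : ℂ) := by
    rw [MvPolynomial.smul_monomial]; simp
  rw [this]
  exact S.smul_mem _ (hmono m.1 m.2)

/-! ### Symmetric invariant multilinear maps -/

/-- A multilinear map on cubic forms which is symmetric and invariant under unimodular
substitutions (on products of linear forms). -/
def Good {ι : Type} (M : MultilinearMap ℂ (fun _ : ι => MvPolynomial (Fin 6) ℂ) ℂ) : Prop :=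
  (∀ (π : Equiv.Perm ι) v, M (fun i => v (π i)) = M v) ∧
  ∀ A : Matrix (Fin 6) (Fin 6) ℂ, A.det = 1 → ∀ a : ι → Fin 3 → Fin 6 → ℂ,
    M (fun i => q (fun k => Matrix.vecMul (a i k) A)) = M (fun i => q (a i))

theorem Good.domDomCongr {ι κ : Type}
    {M : MultilinearMap ℂ (fun _ : ι => MvPolynomial (Fin 6) ℂ) ℂ} (hM : Good M) (e : ι ≃ κ) : Good (M.domDomCongr e) := by
  refine ⟨fun π v => ?_, fun A hA a => ?_⟩
  · have := hM.1 (e.trans (π.trans e.symm)) (fun i => v (e i))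
    simpa [MultilinearMap.domDomCongr_apply] using this
  · exact hM.2 A hA (fun i => a (e i))

section good
variable {ι : Type} [Fintype ι] {M : MultilinearMap ℂ (fun _ : ι => MvPolynomial (Fin 6) ℂ) ℂ}

theorem Good.gl (hM : Good M) {k : ℕ} (hk : Fintype.card ι = 2 * k)
    (A : Matrix (Fin 6) (Fin 6) ℂ) (hA : A.det ≠ 0) (a : ι → Fin 3 → Fin 6 → ℂ) :
    M (fun i => q (fun k => Matrix.vecMul (a i k) A)) = A.det ^ k * M (fun i => q (a i)) := by
  obtain ⟨s, hs⟩ := IsAlgClosed.exists_pow_nat_eq A.det (n := 6) (by norm_num)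
  have hs0 : s ≠ 0 := by
    rintro rfl
    apply hA
    rw [← hs]
    simp
  have hdet : (s⁻¹ • A).det = 1 := by
    rw [Matrix.det_smul, ← hs, Fintype.card_fin, inv_pow]
    exact inv_mul_cancel₀ (pow_ne_zero _ hs0)
  have h1 : ∀ i, q (fun k => Matrix.vecMul (a i k) A) =
      s ^ 3 • q (fun k => Matrix.vecMul (a i k) (s⁻¹ • A)) := by
    intro i
    have h2 := q_smul (fun _ => s) (fun k => Matrix.vecMul (a i k) (s⁻¹ • A))
    simp only [Finset.prod_const, Finset.card_univ, Fintype.card_fin] at h2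
    rw [← h2]
    congr 1
    funext k
    rw [Matrix.vecMul_smul, smul_smul, mul_inv_cancel₀ hs0, one_smul]
  simp only [h1]
  rw [M.map_smul_univ (fun _ => s ^ 3), hM.2 _ hdet]
  simp only [Finset.prod_const, Finset.card_univ, hk, smul_eq_mul]
  rw [← hs]
  ring

/-- The rank-one perturbation of the identity. -/
def rk (c r : Fin 6 → ℂ) : Matrix (Fin 6) (Fin 6) ℂ := 1 + Matrix.vecMulVec c r

theorem det_rk (c r : Fin 6 → ℂ) : (rk c r).det = 1 + r ⬝ᵥ c := by
  rw [rk, Matrix.vecMulVec_eq Unit]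
  exact Matrix.det_one_add_replicateCol_mul_replicateRow c r

theorem vecMul_rk (a c r : Fin 6 → ℂ) : Matrix.vecMul a (rk c r) = a + (a ⬝ᵥ c) • r := by
  rw [rk, Matrix.vecMul_add, Matrix.vecMul_one, Matrix.vecMul_vecMulVec]

theorem Good.degenerate (hM : Good M) {k : ℕ} (hk : Fintype.card ι = 2 * k) (hk0 : k ≠ 0)
    (a : ι → Fin 3 → Fin 6 → ℂ) (w : Fin 6 → ℂ) (hw : w ≠ 0) (h : ∀ i k, a i k ⬝ᵥ w = 0) :
    M (fun i => q (a i)) = 0 := by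
  obtain ⟨p, hp⟩ := Function.ne_iff.1 hw
  have hp : w p ≠ 0 := hp
  have hdet : (rk w (Pi.single p (w p)⁻¹)).det = 2 := by
    rw [det_rk, single_dotProduct, inv_mul_cancel₀ hp]
    norm_num
  have h1 := hM.gl hk _ (by rw [hdet]; norm_num) a
  simp only [vecMul_rk, h, zero_smul, add_zero, hdet] at h1
  have h2 : ((2 : ℂ) ^ k - 1) * M (fun i => q (a i)) = 0 := by linear_combination -h1
  rcases mul_eq_zero.1 h2 with h3 | h3
  · exfalso
    have h4 : ((2 ^ k : ℕ) : ℂ) = (1 : ℕ) := by push_cast; linear_combination h3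
    have h5 := Nat.cast_injective h4
    exact hk0 (by simpa using h5)
  · exact h3

theorem Good.reduce (hM : Good M) {k : ℕ} (hk : Fintype.card ι = 2 * k) (hk0 : k ≠ 0)
    (a : ι → Fin 6 → ℂ) (ha : M (fun i => q (fun _ => a i)) ≠ 0) :
    ∃ (e : Fin 6 → ι) (b : ι → Fin 6 → ℂ), Function.Injective e ∧
      (∀ i, b (e i) = Pi.single i 1) ∧ M (fun i => q (fun _ => b i)) ≠ 0 := by
  by_cases hsp : Submodule.span ℂ (Set.range a) = ⊤
  · obtain ⟨κ, f, hf, hs, hli⟩ := exists_linearIndependent' ℂ a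
    let B := Module.Basis.mk hli (by rw [hs, hsp])
    have : Finite κ := Finite.of_injective f hf
    have : Fintype κ := Fintype.ofFinite κ
    have hcard : Fintype.card κ = 6 := by
      rw [← Module.finrank_eq_card_basis B]; simp
    let ε : Fin 6 ≃ κ := (Fintype.equivFinOfCardEq hcard).symm
    let A : Matrix (Fin 6) (Fin 6) ℂ := Matrix.of fun i => a (f (ε i))
    have hA : IsUnit A := by
      rw [← Matrix.linearIndependent_rows_iff_isUnit]
      exact hli.comp ε ε.injective
    have hAd : IsUnit A.det := (Matrix.isUnit_iff_isUnit_det A).1 hA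
    refine ⟨fun i => f (ε i), fun i => Matrix.vecMul (a i) A⁻¹, hf.comp ε.injective, ?_, ?_⟩
    · intro i
      have : a (f (ε i)) = Matrix.vecMul (Pi.single i 1) A := by
        rw [Matrix.single_one_vecMul]; rfl
      simp only [this]
      rw [Matrix.vecMul_vecMul, Matrix.mul_nonsing_inv A hAd, Matrix.vecMul_one]
    · intro h0
      apply ha
      have h1 := hM.gl hk A hAd.ne_zero (fun i _ => Matrix.vecMul (a i) A⁻¹)
      simp only [Matrix.vecMul_vecMul, Matrix.nonsing_inv_mul A hAd, Matrix.vecMul_one] at h1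
      rw [h1, h0, mul_zero]
  · exfalso
    apply ha
    obtain ⟨f, hf0, hf⟩ := Submodule.exists_le_ker_of_lt_top _ (lt_top_iff_ne_top.2 hsp)
    have hfe : ∀ x : Fin 6 → ℂ, f x = x ⬝ᵥ (fun j => f (Pi.single j 1)) := by
      intro x
      conv_lhs => rw [pi_eq_sum_univ' x]
      simp [dotProduct, map_sum]
    refine hM.degenerate hk hk0 (fun i _ => a i) (fun j => f (Pi.single j 1)) ?_ ?_
    · intro h0
      apply hf0
      ext x
      simpa using congrFun h0 x
    · intro i _
      rw [← hfe]
      exact hf (Submodule.subset_span ⟨i, rfl⟩)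

theorem vecMul_perm (σ : Equiv.Perm (Fin 6)) (i : Fin 6) :
    Matrix.vecMul (Pi.single i (1 : ℂ)) (σ.permMatrix ℂ) = Pi.single (σ i) 1 := by
  rw [Matrix.single_one_vecMul]
  funext j
  simp [Equiv.Perm.permMatrix, PEquiv.toMatrix_apply, Equiv.toPEquiv_apply, Pi.single_apply,
    Matrix.row, eq_comm]

end good

theorem good_six {M : MultilinearMap ℂ (fun _ : Fin 6 => MvPolynomial (Fin 6) ℂ) ℂ}
    (hM : Good M) : M (fun i => q (fun _ => Pi.single i 1)) = 0 := by
  have hdet : ((Equiv.swap (0 : Fin 6) 1).permMatrix ℂ).det = -1 := by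
    rw [Matrix.det_permutation, Equiv.Perm.sign_swap (by decide)]; simp
  have h1 := hM.gl (k := 3) (by simp) _ (by rw [hdet]; norm_num)
    (fun i _ => Pi.single i (1 : ℂ))
  simp only [vecMul_perm, hdet] at h1
  have h2 := hM.1 (Equiv.swap (0 : Fin 6) 1) (fun i => q (fun _ => Pi.single i 1))
  rw [h2] at h1
  linear_combination (1 / 2) * h1

/-! ### Degree eight -/

section eight
variable {M : MultilinearMap ℂ (fun _ : Fin 6 ⊕ Fin 2 => MvPolynomial (Fin 6) ℂ) ℂ}

/-- The bilinear map obtained by putting the cubes of the coordinates in the first six slots. -/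
def NN (M : MultilinearMap ℂ (fun _ : Fin 6 ⊕ Fin 2 => MvPolynomial (Fin 6) ℂ) ℂ) :
    MultilinearMap ℂ (fun _ : Fin 2 => MvPolynomial (Fin 6) ℂ) ℂ :=
  M.currySum (fun i => q (fun _ => Pi.single i 1))

theorem NN_apply (u : Fin 2 → Fin 3 → Fin 6 → ℂ) :
    NN M (fun j => q (u j)) =
      M (fun x => q (Sum.elim (fun i _ => Pi.single i 1) u x)) := by
  rw [NN, MultilinearMap.currySum_apply]
  refine congrArg M (funext fun x => ?_)
  cases x <;> rfl

/-- Values of `NN` at pairs of monomials. -/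
def DD (M : MultilinearMap ℂ (fun _ : Fin 6 ⊕ Fin 2 => MvPolynomial (Fin 6) ℂ) ℂ)
    (κ : Fin 2 → Fin 3 → Fin 6) : ℂ :=
  NN M (fun j => q (fun k => Pi.single (κ j k) 1))

theorem q_expand (a : Fin 3 → Fin 6 → ℂ) :
    q a = ∑ f : Fin 3 → Fin 6, (∏ k, a k (f k)) • q (fun k => Pi.single (f k) 1) := by
  have h : ∀ f : Fin 3 → Fin 6, (∏ k, a k (f k)) • q (fun k => Pi.single (f k) 1) =
      ∏ k, (a k (f k) • (X (f k) : MvPolynomial (Fin 6) ℂ)) := by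
    intro f
    simp only [q, lin_single, Finset.prod_smul]
  simp only [h]
  rw [q]
  simp only [lin_apply]
  rw [Finset.prod_univ_sum, Fintype.piFinset_univ]

theorem NN_expand (u : Fin 2 → Fin 3 → Fin 6 → ℂ) :
    NN M (fun j => q (u j)) =
      ∑ κ : Fin 2 → Fin 3 → Fin 6, (∏ j, ∏ k, u j k (κ j k)) * DD M κ := by
  have h : (fun j => q (u j)) = fun j => ∑ f : Fin 3 → Fin 6,
      (∏ k, u j k (f k)) • q (fun k => Pi.single (f k) 1) := by
    funext j
    exact q_expand (u j)
  rw [h, MultilinearMap.map_sum]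
  refine Finset.sum_congr rfl fun κ _ => ?_
  rw [MultilinearMap.map_smul_univ (NN M) (fun j => ∏ k, u j k (κ j k))]
  rfl

theorem DD_zero (hM : Good M) (κ : Fin 2 → Fin 3 → Fin 6) (p : Fin 6)
    (hp : ∀ j k, κ j k ≠ p) : DD M κ = 0 := by
  let e : Fin 6 → ℂ := Pi.single p 1
  have hdet : (rk e e).det = 2 := by
    rw [det_rk]; simp [e]; norm_num
  have h1 := hM.gl (k := 4) (by simp) (rk e e) (by rw [hdet]; norm_num)
    (Sum.elim (fun i _ => Pi.single i 1) (fun j k => Pi.single (κ j k) 1))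
  rw [← NN_apply, hdet] at h1
  have h2 : ∀ x, q (fun k => Matrix.vecMul
      ((Sum.elim (fun i _ => Pi.single i 1) (fun j k => Pi.single (κ j k) 1) :
        Fin 6 ⊕ Fin 2 → Fin 3 → Fin 6 → ℂ) x k) (rk e e)) =
      (if x = Sum.inl p then (8 : ℂ) else 1) •
        q (Sum.elim (fun i _ => Pi.single i 1) (fun j k => Pi.single (κ j k) 1) x) := by
    intro x
    rcases x with i | j
    · by_cases hi : i = p
      · subst hi
        have := q_smul (fun _ => 2) (fun _ => e)
        simp only [Sum.elim_inl, if_true]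
        rw [Finset.prod_const] at this
        norm_num at this
        rw [← this]
        refine congrArg q (funext fun k => ?_)
        rw [vecMul_rk]
        simp [e, two_smul]
      · have hi' : (Sum.inl i : Fin 6 ⊕ Fin 2) ≠ Sum.inl p := by simpa using hi
        rw [if_neg hi', one_smul]
        refine congrArg q (funext fun k => ?_)
        rw [vecMul_rk]
        simp [e, Ne.symm hi]
    · rw [if_neg (by simp), one_smul]
      refine congrArg q (funext fun k => ?_)
      rw [vecMul_rk]
      have := hp j k
      simp [e, this.symm]
  simp only [h2] at h1
  rw [M.map_smul_univ (fun x => if x = Sum.inl p then (8 : ℂ) else 1), ← NN_apply,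
    Finset.prod_ite_eq'] at h1
  simp only [Finset.mem_univ, if_true, smul_eq_mul] at h1
  change (8 : ℂ) * DD M κ = 2 ^ 4 * DD M κ at h1
  linear_combination (-1 / 8) * h1

theorem DD_perm (hM : Good M) (κ : Fin 2 → Fin 3 → Fin 6) (σ : Equiv.Perm (Fin 6)) :
    DD M (fun j k => σ (κ j k)) = DD M κ := by
  have hdet : (σ.permMatrix ℂ).det ^ 4 = 1 ∧ (σ.permMatrix ℂ).det ≠ 0 := by
    rw [Matrix.det_permutation]
    rcases Int.units_eq_one_or (Equiv.Perm.sign σ) with h | h <;> rw [h] <;> norm_num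
  have h1 := hM.gl (k := 4) (by simp) (σ.permMatrix ℂ) hdet.2
    (Sum.elim (fun i _ => Pi.single i 1) (fun j k => Pi.single (κ j k) 1))
  rw [← NN_apply, hdet.1, one_mul] at h1
  have h2 := hM.1 (Equiv.sumCongr σ 1)
    (fun x => q (Sum.elim (fun i _ => Pi.single i 1) (fun j k => Pi.single (σ (κ j k)) 1) x))
  rw [DD, NN_apply, ← h2, DD, ← h1]
  refine congrArg M (funext fun x => congrArg q (funext fun k => ?_))
  rcases x with i | j
  · exact (vecMul_perm σ i).symm
  · exact (vecMul_perm σ (κ j k)).symm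

theorem DD_sum (hM : Good M) : ∑ κ : Fin 2 → Fin 3 → Fin 6, DD M κ = 0 := by
  have h1 := NN_expand (M := M) (fun _ _ _ => 1)
  simp only [Finset.prod_const_one, one_mul] at h1
  rw [← h1, NN_apply]
  let w : Fin 6 → ℂ := fun _ => 1
  let e : Fin 6 → ℂ := Pi.single 5 1
  let A := rk e (w - e)
  have hdet : A.det = 1 := by
    rw [det_rk]; simp [e, w]
  have h2 := hM.1 (Equiv.swap (Sum.inl 5) (Sum.inr 0))
    (fun x => q (Sum.elim (fun i _ => Pi.single i 1) (fun _ _ _ => 1) x))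
  rw [← h2]
  let u : Fin 2 → Fin 3 → Fin 6 → ℂ := ![fun _ => 2 • e - w, fun _ => e]
  have h3 := hM.2 A hdet (Sum.elim (fun i _ => Pi.single i 1) u)
  have h4 : (fun x => q (fun k => Matrix.vecMul
      (Sum.elim (fun i _ => Pi.single i 1) u x k) A)) =
      fun x => q (Sum.elim (fun i _ => Pi.single i 1) (fun _ _ _ => 1)
        ((Equiv.swap (Sum.inl 5 : Fin 6 ⊕ Fin 2) (Sum.inr 0)) x)) := by
    refine funext fun x => congrArg q (funext fun k => ?_)
    rcases x with i | j
    · by_cases hi : i = 5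
      · subst hi
        rw [vecMul_rk, Equiv.swap_apply_left]
        simp [e, w]
      · rw [vecMul_rk, Equiv.swap_apply_of_ne_of_ne (by simpa using hi) (by simp)]
        simp [e, Ne.symm hi]
    · fin_cases j
      · simp only [Fin.zero_eta, Equiv.swap_apply_right]
        rw [vecMul_rk]
        simp [u, e, w]
        norm_num
        rw [two_mul]
        abel
      · simp only [Fin.mk_one]
        rw [vecMul_rk, Equiv.swap_apply_of_ne_of_ne (by simp) (by simp)]
        simp [u, e, w]
  rw [h4] at h3
  rw [h3, ← NN_apply, NN_expand]
  refine Finset.sum_eq_zero fun κ _ => ?_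
  by_cases hκ : ∀ k, κ 1 k = 5
  · have : ∃ p, ∀ j k, κ j k ≠ p := by
      have hex : ∃ p : Fin 6, p ∉ ({κ 0 0, κ 0 1, κ 0 2, 5} : Finset (Fin 6)) := by
        by_contra! hall
        have h6 : (Finset.univ : Finset (Fin 6)) ⊆ {κ 0 0, κ 0 1, κ 0 2, 5} := fun p _ => hall p
        have h7 := (Finset.card_le_card h6).trans Finset.card_le_four
        simp at h7
      obtain ⟨p, hp⟩ := hex
      simp only [Finset.mem_insert, Finset.mem_singleton, not_or] at hp
      obtain ⟨a, b, c, d⟩ := hp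
      refine ⟨p, fun j k => ?_⟩
      fin_cases j
      · fin_cases k
        · exact Ne.symm a
        · exact Ne.symm b
        · exact Ne.symm c
      · exact fun h => d (h.symm.trans (hκ k))
    obtain ⟨p, hp⟩ := this
    rw [DD_zero hM κ p hp, mul_zero]
  · push Not at hκ
    obtain ⟨k, hk⟩ := hκ
    have : ∏ k, u 1 k (κ 1 k) = 0 :=
      Finset.prod_eq_zero (Finset.mem_univ k) (by simp [u, e, hk])
    rw [Fin.prod_univ_two, this, mul_zero, zero_mul]

theorem DD_eq_zero (hM : Good M) (κ : Fin 2 → Fin 3 → Fin 6) : DD M κ = 0 := by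
  classical
  by_contra h0
  have surj : ∀ κ : Fin 2 → Fin 3 → Fin 6, DD M κ ≠ 0 →
      Function.Bijective (fun x : Fin 2 × Fin 3 => κ x.1 x.2) := by
    intro κ h
    rw [Fintype.bijective_iff_surjective_and_card]
    refine ⟨?_, by simp⟩
    intro p
    by_contra! hp
    exact h (DD_zero hM κ p fun j k => hp (j, k))
  have hall : ∀ κ', DD M κ' = if DD M κ' ≠ 0 then DD M κ else 0 := by
    intro κ'
    split_ifs with h
    · let E := Equiv.ofBijective _ (surj κ h0)
      let E' := Equiv.ofBijective _ (surj κ' h)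
      rw [← DD_perm hM κ (E.symm.trans E')]
      congr 1
      funext j k
      have : κ j k = E (j, k) := rfl
      rw [this]
      simp [E']
    · push Not at h
      exact h
  have hs := DD_sum hM
  rw [Finset.sum_congr rfl (fun κ' _ => hall κ'), ← Finset.sum_filter, Finset.sum_const,
    nsmul_eq_mul] at hs
  rcases mul_eq_zero.1 hs with h | h
  · rw [Nat.cast_eq_zero, Finset.card_eq_zero] at h
    have : κ ∈ (Finset.univ.filter fun κ' => DD M κ' ≠ 0) := by simp [h0]
    rw [h] at this
    simp at this
  · exact h0 h

theorem good_eight (hM : Good M) (b : Fin 6 ⊕ Fin 2 → Fin 6 → ℂ)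
    (hb : ∀ i, b (Sum.inl i) = Pi.single i 1) : M (fun i => q (fun _ => b i)) = 0 := by
  have h1 := NN_apply (M := M) (fun j _ => b (Sum.inr j))
  rw [NN_expand] at h1
  simp only [DD_eq_zero hM, mul_zero, Finset.sum_const_zero] at h1
  rw [h1]
  refine congrArg M (funext fun x => ?_)
  rcases x with i | j
  · simp [hb]
  · simp

end eight

/-! ### Conclusion -/

theorem good_cubes {d : ℕ} (hd1 : 1 ≤ d) (hd9 : d ≤ 9)
    {M : MultilinearMap ℂ (fun _ : Fin d => MvPolynomial (Fin 6) ℂ) ℂ} (hM : Good M)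
    (a : Fin d → Fin 6 → ℂ) : M (fun i => q (fun _ => a i)) = 0 := by
  rcases Nat.even_or_odd' d with ⟨k, hk | hk⟩
  · by_contra hne
    obtain ⟨e, b, he, hb, hne⟩ := hM.reduce (k := k) (by simpa using hk) (by omega) a hne
    have h6 : 6 ≤ d := by simpa using Fintype.card_le_of_injective e he
    have hk' : k = 3 ∨ k = 4 := by omega
    rcases hk' with rfl | rfl
    · let E : Fin 6 ≃ Fin d := Equiv.ofBijective e
        ((Fintype.bijective_iff_injective_and_card e).2 ⟨he, by simp [hk]⟩)
      have h := good_six (hM.domDomCongr E.symm)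
      rw [MultilinearMap.domDomCongr_apply] at h
      apply hne
      rw [← h]
      refine congrArg M (funext fun i => congrArg q (funext fun _ => ?_))
      rw [← hb]
      refine congrArg b ?_
      exact (E.apply_symm_apply i).symm
    · have hcard : Fintype.card {x // x ∉ Set.range e} = 2 := by
        rw [Fintype.card_subtype_compl]
        have : Fintype.card {x // x ∈ Set.range e} = 6 := by
          rw [← Fintype.card_congr (Equiv.ofInjective e he)]; simp
        rw [this]
        simp [hk]
      let E : Fin 6 ⊕ Fin 2 ≃ Fin d :=
        (Equiv.sumCongr (Equiv.ofInjective e he) (Fintype.equivFinOfCardEq hcard).symm).trans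
          (Equiv.sumCompl (fun x => x ∈ Set.range e))
      have h := good_eight (hM.domDomCongr E.symm) (fun x => b (E x)) (by
        intro i
        rw [← hb]
        rfl)
      rw [MultilinearMap.domDomCongr_apply] at h
      simp only [Equiv.apply_symm_apply] at h
      exact hne h
  · have h1 := hM.2 (-1) (by rw [Matrix.det_neg]; simp; norm_num) (fun i _ => a i)
    have h2 : ∀ i, q (fun _ => Matrix.vecMul (a i) (-1)) = (-1 : ℂ) • q (fun _ => a i) := by
      intro i
      have := q_smul (fun _ => -1) (fun _ => a i)
      rw [Finset.prod_const] at this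
      norm_num at this
      rw [Matrix.vecMul_neg, Matrix.vecMul_one, this]
      simp
    simp only [h2] at h1
    rw [M.map_smul_univ (fun _ => (-1 : ℂ)), Finset.prod_const, Finset.card_univ,
      Fintype.card_fin, Odd.neg_one_pow ⟨k, hk⟩] at h1
    simp only [smul_eq_mul] at h1
    linear_combination (-1 / 2) * h1

theorem diag_zero {d : ℕ} {M : MultilinearMap ℂ (fun _ : Fin d => MvPolynomial (Fin 6) ℂ) ℂ}
    (h : ∀ a : Fin d → Fin 6 → ℂ, M (fun i => q (fun _ => a i)) = 0)
    (f : MvPolynomial (Fin 6) ℂ) (hf : f.IsHomogeneous 3) : M (fun _ => f) = 0 := by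
  have hs := hom_mem_span f hf
  rw [Finsupp.mem_span_range_iff_exists_finsupp] at hs
  obtain ⟨c, rfl⟩ := hs
  simp only [Finsupp.sum]
  rw [MultilinearMap.map_sum_finset]
  refine Finset.sum_eq_zero fun r _ => ?_
  rw [M.map_smul_univ (fun i => c (r i)), h, smul_zero]

/-- There is no nonzero `SL₆(ℂ)`-invariant polynomial function,
homogeneous of degree `d` with `1 ≤ d ≤ 9`, on the 56-dimensional space of homogeneous
cubic forms in six variables (the action being `(g·f)(x) = f(g⁻¹x)`). -/
theorem no_low_degree_SL6_invariant_on_cubics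
    (Φ : MvPolynomial CubicMonomial ℂ) (d : ℕ) (hd1 : 1 ≤ d) (hd9 : d ≤ 9)
    (hhom : Φ.IsHomogeneous d)
    (hinv : ∀ (g : Matrix.SpecialLinearGroup (Fin 6) ℂ) (f : MvPolynomial (Fin 6) ℂ),
      f.IsHomogeneous 3 → evalAtCubic Φ (slAct g f) = evalAtCubic Φ f) :
    Φ = 0 := by
  obtain ⟨P, hsym, hL, hdiag⟩ := exists_polar Φ d hhom
  let M : MultilinearMap ℂ (fun _ : Fin d => MvPolynomial (Fin 6) ℂ) ℂ :=
    P.compLinearMap (fun _ => coeffs)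
  have hM : Good M := by
    refine ⟨fun π v => hsym π (fun i => coeffs (v i)), fun A hA a => ?_⟩
    let g : Matrix.SpecialLinearGroup (Fin 6) ℂ := (⟨A, hA⟩ : Matrix.SpecialLinearGroup _ _)⁻¹
    have hg : ∀ f, slAct g f = subst A f := by
      intro f
      have hgi : g⁻¹ = ⟨A, hA⟩ := inv_inv _
      rw [slAct_eq, hgi]
    have h1 := hL (coeffs ∘ₗ (subst A).toLinearMap ∘ₗ ofCoeffs) (by
      intro w
      have h2 := hinv g (ofCoeffs w) (ofCoeffs_hom w)
      rw [hg] at h2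
      change eval (coeffs (subst A (ofCoeffs w))) Φ = eval (coeffs (ofCoeffs w)) Φ at h2
      rw [coeffs_ofCoeffs] at h2
      exact h2) (fun i => coeffs (q (a i)))
    simp only [LinearMap.comp_apply, AlgHom.toLinearMap_apply, ofCoeffs_coeffs _ (q_hom _),
      subst_q] at h1
    exact h1
  refine MvPolynomial.funext fun w => ?_
  have h1 := diag_zero (good_cubes hd1 hd9 hM) (ofCoeffs w) (ofCoeffs_hom w)
  have h2 : M (fun _ => ofCoeffs w) = P (fun _ => coeffs (ofCoeffs w)) := rfl
  rw [h2, coeffs_ofCoeffs, hdiag] at h1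
  rw [map_zero]
  exact (mul_eq_zero.1 h1).resolve_left (by exact_mod_cast d.factorial_ne_zero)

end SLInvariants
end
end
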